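/- arXiv:0805.3527 — 3 statements merged into one kernel-verified Lean document; each statement's English description precedes it below -/
import Mathlib

section
/- Let k be a commutative ring and A a commutative k-algebra that is flat as a k-module. Let J ⊆ A be an ideal and S = A/J. Regard A as an (A⊗_kA)-module via the multiplication map μ_A: A⊗_kA → A, and S⊗_kA as an (A⊗_kA)-module via the quotient map π⊗id: A⊗_kA → S⊗_kA. Then Tor₁^{A⊗_kA}(S⊗_kA, A) = 0. -/
/-!
STATEMENT 1: For a commutative ring `k`, a flat commutative `k`-algebra `A`, an ideal
`J ⊆ A` with `S = A/J`, regarding `A` as an `(A ⊗[k] A)`-module via the multiplication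
map `μ_A` and `S ⊗[k] A` as an `(A ⊗[k] A)`-module via `π ⊗ id`, we have
`Tor₁^{A⊗[k]A}(S ⊗[k] A, A) = 0`.
-/

open TensorProduct CategoryTheory CategoryTheory.Limits

noncomputable section

variable (k A : Type) [CommRing k] [CommRing A] [Algebra k A] (J : Ideal A)

/-- The multiplication map `μ_A : A ⊗[k] A → A`. -/
abbrev mulMap : A ⊗[k] A →ₐ[k] A := Algebra.TensorProduct.lmul' k

/-- The quotient map `π : A → S = A/J`. -/
abbrev qmap : A →ₐ[k] A ⧸ J := Ideal.Quotient.mkₐ k J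

/-- The map `π ⊗ id : A ⊗[k] A → S ⊗[k] A`. -/
abbrev toSA : A ⊗[k] A →ₐ[k] (A ⧸ J) ⊗[k] A :=
  Algebra.TensorProduct.map (qmap k A J) (AlgHom.id k A)

/-- `A` as a module over `A ⊗[k] A` via the multiplication map `μ_A`. -/
def Amodule : Module (A ⊗[k] A) A := Module.compHom A (mulMap k A).toRingHom

/-- `S ⊗[k] A` as a module over `A ⊗[k] A` via `π ⊗ id`. -/
def SAmodule : Module (A ⊗[k] A) ((A ⧸ J) ⊗[k] A) :=
  Module.compHom ((A ⧸ J) ⊗[k] A) (toSA k A J).toRingHom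

attribute [local instance] Amodule SAmodule

section Helpers

variable {R B : Type*} [CommRing R] [CommRing B] [Algebra R B]

theorem ker_inf_map_smul_top_le {P M : Type*} [AddCommGroup P] [AddCommGroup M] [Module B P]
    [Module B M] [Module R P] [Module R M] [IsScalarTower R B P] [IsScalarTower R B M]
    [Module.Projective R M] (I : Ideal R) (ε : P →ₗ[B] M) (hε : Function.Surjective ε) :
    LinearMap.ker ε ⊓ I.map (algebraMap R B) • ⊤ ≤ I.map (algebraMap R B) • LinearMap.ker ε := by
  obtain ⟨s, hs⟩ := Module.projective_lifting_property (ε.restrictScalars R) LinearMap.id hε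
  replace hs (m : M) : ε (s m) = m := LinearMap.congr_fun hs m
  have smul_sub_mem {b : B} (hb : b ∈ I.map (algebraMap R B)) :
      ∀ y : P, b • y - s (ε (b • y)) ∈ I.map (algebraMap R B) • LinearMap.ker ε := by
    induction hb using Submodule.span_induction with
    | mem b hb =>
      obtain ⟨r, hr, rfl⟩ := hb
      intro y
      rw [map_smul, algebraMap_smul, algebraMap_smul, map_smul, ← smul_sub, ← algebraMap_smul B r]
      exact Submodule.smul_mem_smul (Ideal.mem_map_of_mem _ hr) (by simp [hs])
    | zero => simp
    | add b c _ _ hb hc =>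
      intro y
      simpa only [add_smul, map_add, add_sub_add_comm] using add_mem (hb y) (hc y)
    | smul a b _ hb =>
      intro y
      simpa only [smul_eq_mul, mul_comm a b, mul_smul] using hb (a • y)
  rintro x ⟨hx, hx'⟩
  suffices h : x - s (ε x) ∈ I.map (algebraMap R B) • LinearMap.ker ε by
    simpa [LinearMap.mem_ker.mp hx] using h
  clear hx
  induction hx' using Submodule.smul_induction_on' with
  | smul b hb y _ => exact smul_sub_mem hb y
  | add x _ y _ hx hy => simpa only [map_add, add_sub_add_comm] using add_mem hx hy

theorem one_tmul_eq_zero_iff_mem_smul_top {Q : Type*} [AddCommGroup Q] [Module B Q] (𝔞 : Ideal B)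
    (q : Q) : (1 : B ⧸ 𝔞) ⊗ₜ[B] q = 0 ↔ q ∈ 𝔞 • (⊤ : Submodule B Q) := by
  rw [← (quotTensorEquivQuotSMul Q 𝔞).map_eq_zero_iff, quotTensorEquivQuotSMul_mk_one_tmul,
    Submodule.Quotient.mk_eq_zero]

theorem exact_lTensor_quotient {P₂ P₁ P₀ : Type*} [AddCommGroup P₂] [AddCommGroup P₁]
    [AddCommGroup P₀] [Module B P₂] [Module B P₁] [Module B P₀] (𝔞 : Ideal B)
    {d₂ : P₂ →ₗ[B] P₁} {d₁ : P₁ →ₗ[B] P₀} (h : Function.Exact d₂ d₁)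
    (h𝔞 : LinearMap.range d₁ ⊓ 𝔞 • ⊤ ≤ 𝔞 • LinearMap.range d₁) :
    Function.Exact (d₂.lTensor (B ⧸ 𝔞)) (d₁.lTensor (B ⧸ 𝔞)) := by
  intro x
  constructor
  · obtain ⟨q, rfl⟩ := (quotTensorEquivQuotSMul P₁ 𝔞).symm.surjective x
    obtain ⟨p, rfl⟩ := Submodule.Quotient.mk_surjective _ q
    rw [quotTensorEquivQuotSMul_symm_mk, LinearMap.lTensor_tmul,
      one_tmul_eq_zero_iff_mem_smul_top]
    intro hp
    have hp' := h𝔞 ⟨⟨p, rfl⟩, hp⟩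
    rw [LinearMap.range_eq_map, ← Submodule.map_smul''] at hp'
    obtain ⟨q, hq, hqp⟩ := hp'
    obtain ⟨y, hy⟩ := (h (p - q)).mp (by rw [map_sub, hqp, sub_self])
    refine ⟨1 ⊗ₜ y, ?_⟩
    rw [LinearMap.lTensor_tmul, hy, tmul_sub, (one_tmul_eq_zero_iff_mem_smul_top 𝔞 q).mpr hq,
      sub_zero]
  · rintro ⟨y, rfl⟩
    rw [← LinearMap.comp_apply, ← LinearMap.lTensor_comp, h.linearMap_comp_eq_zero,
      LinearMap.lTensor_zero, LinearMap.zero_apply]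

end Helpers

/-- If `M` is a `B`-module that is projective over `R`, then `Tor₁(B / I B, M) = 0`. -/
theorem isZero_Tor_one_quotient_map {R B : Type} [CommRing R] [CommRing B] [Algebra R B]
    (I : Ideal R) (M : Type) [AddCommGroup M] [Module B M] [Module R M] [IsScalarTower R B M]
    [Module.Projective R M] :
    IsZero (((Tor (ModuleCat B) 1).obj (ModuleCat.of B (B ⧸ I.map (algebraMap R B)))).obj
      (ModuleCat.of B M)) := by
  let P := projectiveResolution (ModuleCat.of B M)
  refine IsZero.of_iso ?_ (P.isoLeftDerivedObj _ 1)
  refine (HomologicalComplex.exactAt_iff_isZero_homology _ _).mp ?_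
  rw [HomologicalComplex.exactAt_iff' _ 2 1 0 (by simp) (by simp),
    ShortComplex.ShortExact.moduleCat_exact_iff_function_exact]
  have h₁ := (ShortComplex.ShortExact.moduleCat_exact_iff_function_exact _).mp (P.exact_succ 0)
  have h₀ := (ShortComplex.ShortExact.moduleCat_exact_iff_function_exact _).mp P.exact₀
  have hπ : Function.Surjective (P.π.f 0) := (ModuleCat.epi_iff_surjective _).mp inferInstance
  refine exact_lTensor_quotient (d₂ := (P.complex.d 2 1).hom) (d₁ := (P.complex.d 1 0).hom)
    _ h₁ ?_
  let ε : P.complex.X 0 →ₗ[B] M := (P.π.f 0).hom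
  have hker : LinearMap.ker ε = LinearMap.range (P.complex.d 1 0).hom :=
    LinearMap.exact_iff.mp h₀
  rw [← hker]
  let _ : Module R (P.complex.X 0) := Module.compHom _ (algebraMap R B)
  have : IsScalarTower R B (P.complex.X 0) := .of_algebraMap_smul fun _ _ => rfl
  exact ker_inf_map_smul_top_le I ε hπ

/-- `S ⊗ A` is the quotient of `A ⊗ A` by the ideal generated by `J ⊗ 1`. -/
def quotientMapEquivSA :
    ((A ⊗[k] A) ⧸ J.map (algebraMap A (A ⊗[k] A))) ≃ₗ[A ⊗[k] A] (A ⧸ J) ⊗[k] A :=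
  let φ : (A ⊗[k] A) →ₗ[A ⊗[k] A] (A ⧸ J) ⊗[k] A :=
    { toFun := toSA k A J
      map_add' := map_add _
      map_smul' := map_mul _ }
  have hker : J.map (algebraMap A (A ⊗[k] A)) = LinearMap.ker φ := by
    have h := Algebra.TensorProduct.rTensor_ker (R := k) (C := A) (qmap k A J)
      (Ideal.Quotient.mkₐ_surjective k J)
    rw [show RingHom.ker (qmap k A J) = J from Ideal.Quotient.mkₐ_ker k J] at h
    exact h.symm
  (Submodule.quotEquivOfEq _ _ hker).trans (φ.quotKerEquivOfSurjective
    (Algebra.TensorProduct.map_surjective _ _ (Ideal.Quotient.mkₐ_surjective k J)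
      Function.surjective_id))

theorem statement1 [Module.Flat k A] :
    IsZero (((Tor (ModuleCat (A ⊗[k] A)) 1).obj
        (ModuleCat.of (A ⊗[k] A) ((A ⧸ J) ⊗[k] A))).obj
      (ModuleCat.of (A ⊗[k] A) A)) := by
  have : IsScalarTower A (A ⊗[k] A) A := .of_algebraMap_smul fun a x => by
    change mulMap k A (a ⊗ₜ 1) * x = a * x
    simp
  exact (isZero_Tor_one_quotient_map J A).of_iso
    (((Tor (ModuleCat (A ⊗[k] A)) 1).mapIso (quotientMapEquivSA k A J).toModuleIso.symm).app _)

end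
end

section
/- Let k be a commutative ring, R a commutative k-algebra, and I ⊆ R an ideal with I² = 0; set R₀ = R/I with quotient map π: R → R₀, and assume R₀ is flat as a k-module (e.g. k is a field). Regard R₀ as an (R₀⊗_kR)-module via (r₀⊗r)·s := r₀·s·π(r), and R₀⊗_kR₀ as an (R₀⊗_kR)-module via the surjection id⊗π: R₀⊗_kR → R₀⊗_kR₀. Then there are isomorphisms of R₀-modules Tor₀^{R₀⊗_kR}(R₀, R₀⊗_kR₀) ≅ R₀ and Tor₁^{R₀⊗_kR}(R₀, R₀⊗_kR₀) ≅ I. (These are the cohomology sheaves H⁰(H) ≅ O_{Δ_{X₀}} and H^{-1}(H) ≅ i_{Δ_{X₀}*}(I) of the derived restriction H = h^*h_*O_{Δ_{X₀}} for a square-zero extension X₀ ⊆ X, in the affine case.) -/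
/-!
STATEMENT 6: For a commutative `k`-algebra `R` and an ideal `I ⊆ R` with `I² = 0`,
`R₀ = R/I` flat over `k`, regarding `R₀` as an `(R₀ ⊗[k] R)`-module via
`(r₀ ⊗ r)·s = r₀·s·π(r)` and `R₀ ⊗[k] R₀` as an `(R₀ ⊗[k] R)`-module via `id ⊗ π`,
there are isomorphisms `Tor₀^{R₀⊗R}(R₀, R₀⊗R₀) ≅ R₀` and `Tor₁^{R₀⊗R}(R₀, R₀⊗R₀) ≅ I`.
-/

open TensorProduct CategoryTheory

noncomputable section

variable (k R : Type) [CommRing k] [CommRing R] [Algebra k R] (I : Ideal R)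

/-- The map `R₀ ⊗[k] R → R₀`, `r₀ ⊗ r ↦ r₀ · π(r)`. -/
def gmap : (R ⧸ I) ⊗[k] R →ₐ[k] R ⧸ I :=
  Algebra.TensorProduct.lift (AlgHom.id k (R ⧸ I)) (Ideal.Quotient.mkₐ k I)
    fun _ _ => Commute.all _ _

/-- `R₀` as an `(R₀ ⊗[k] R)`-module via `(r₀ ⊗ r) · s := r₀ · s · π(r)`. -/
def R0module : Module ((R ⧸ I) ⊗[k] R) (R ⧸ I) := Module.compHom _ (gmap k R I).toRingHom

/-- `R₀ ⊗[k] R₀` as an `(R₀ ⊗[k] R)`-module via `id ⊗ π`. -/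
def RR0module : Module ((R ⧸ I) ⊗[k] R) ((R ⧸ I) ⊗[k] (R ⧸ I)) :=
  Module.compHom _
    (Algebra.TensorProduct.map (AlgHom.id k (R ⧸ I)) (Ideal.Quotient.mkₐ k I)).toRingHom

attribute [local instance] R0module RR0module

/-- Since `I² = 0`, the ideal `I` is a module over `R₀ = R/I`. -/
def Imodule (hI : I ^ 2 = ⊥) : Module (R ⧸ I) I :=
  Module.IsTorsionBySet.module <| by
    intro x a
    ext
    have h : (a : R) * (x : R) ∈ I ^ 2 := by
      rw [pow_two]; exact Ideal.mul_mem_mul a.2 x.2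
    rw [hI] at h
    simpa using h

namespace CategoryTheory

open Limits

variable {C D : Type*} [Category* C] [Abelian C] [Category* D] [Abelian D]

namespace ProjectiveResolution

/-- The augmentation of a projective resolution of `Z`, as a morphism to `Z`. -/
def augmentation {Z : C} (Q : ProjectiveResolution Z) : Q.complex.X 0 ⟶ Z :=
  Q.π.f 0

lemma d_comp_augmentation {Z : C} (Q : ProjectiveResolution Z) :
    Q.complex.d 1 0 ≫ Q.augmentation = 0 :=
  Q.complex_d_comp_π_f_zero

instance {Z : C} (Q : ProjectiveResolution Z) : Epi Q.augmentation :=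
  inferInstanceAs (Epi (Q.π.f 0))

/-- The augmentation is a cokernel of the first differential. -/
def isColimitAugmentation {Z : C} (Q : ProjectiveResolution Z) :
    IsColimit (CokernelCofork.ofπ Q.augmentation Q.d_comp_augmentation) :=
  Q.isColimitCokernelCofork

variable {S : ShortComplex C} (Q : ProjectiveResolution S.X₁)

/-- A projective resolution of `S.X₁` followed by `S.X₂`. -/
def splice : ChainComplex C ℕ :=
  Q.complex.augment (Q.augmentation ≫ S.f) (by
    rw [← Category.assoc, Q.d_comp_augmentation, zero_comp])

lemma splice_d_one_zero_comp : Q.splice.d 1 0 ≫ S.g = 0 :=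
  show (Q.augmentation ≫ S.f) ≫ S.g = 0 by rw [Category.assoc, S.zero, comp_zero]

lemma exact_splice_zero (hS : S.Exact) :
    (ShortComplex.mk (Q.splice.d 1 0) S.g Q.splice_d_one_zero_comp).Exact := by
  let φ : ShortComplex.mk (Q.splice.d 1 0) S.g Q.splice_d_one_zero_comp ⟶ S :=
    { τ₁ := Q.augmentation
      τ₂ := 𝟙 _
      τ₃ := 𝟙 _
      comm₁₂ := (Category.comp_id _).symm
      comm₂₃ := (Category.id_comp _).trans (Category.comp_id _).symm }
  have : Epi φ.τ₁ := inferInstanceAs (Epi Q.augmentation)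
  have : IsIso φ.τ₂ := inferInstanceAs (IsIso (𝟙 S.X₂))
  have : Mono φ.τ₃ := inferInstanceAs (Mono (𝟙 S.X₃))
  exact (ShortComplex.exact_iff_of_epi_of_isIso_of_mono φ).2 hS

lemma exactAt_splice_succ [Mono S.f] (n : ℕ) : Q.splice.ExactAt (n + 1) := by
  rw [HomologicalComplex.exactAt_iff' _ (n + 2) (n + 1) n (by simp) (by simp)]
  rcases n with _ | n
  · let φ : ShortComplex.mk (Q.complex.d 1 0) Q.augmentation Q.d_comp_augmentation ⟶
        Q.splice.sc' 2 1 0 :=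
      { τ₁ := 𝟙 _
        τ₂ := 𝟙 _
        τ₃ := S.f
        comm₁₂ := (Category.id_comp _).trans (Category.comp_id _).symm
        comm₂₃ := Category.id_comp _ }
    have : Epi φ.τ₁ := inferInstanceAs (Epi (𝟙 (Q.complex.X 1)))
    have : IsIso φ.τ₂ := inferInstanceAs (IsIso (𝟙 (Q.complex.X 0)))
    have : Mono φ.τ₃ := inferInstanceAs (Mono S.f)
    exact (ShortComplex.exact_iff_of_epi_of_isIso_of_mono φ).1
      (ShortComplex.exact_of_g_is_cokernel _ Q.isColimitAugmentation)
  · exact Q.exact_succ n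

/-- Splicing a projective resolution of `S.X₁` with a short exact sequence `S` whose middle term
is projective gives a projective resolution of `S.X₃`. -/
def ofShortExact (hS : S.ShortExact) [Projective S.X₂] : ProjectiveResolution S.X₃ where
  complex := Q.splice
  projective
    | 0 => (inferInstance : Projective S.X₂)
    | n + 1 => Q.projective n
  π := (ChainComplex.toSingle₀Equiv _ _).symm ⟨S.g, Q.splice_d_one_zero_comp⟩
  quasiIso := ⟨fun n => by
    have := hS.mono_f
    rcases n with _ | n
    · rw [ChainComplex.quasiIsoAt₀_iff, ShortComplex.quasiIso_iff_of_zeros' _ rfl rfl rfl]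
      refine (ShortComplex.exact_and_epi_g_iff_of_iso
        (S₂ := ShortComplex.mk (Q.splice.d 1 0) S.g Q.splice_d_one_zero_comp) ?_).2
        ⟨Q.exact_splice_zero hS.exact, hS.epi_g⟩
      exact ShortComplex.isoMk (Iso.refl _) (Iso.refl _) (Iso.refl _)
        ((Category.id_comp _).trans (Category.comp_id _).symm)
        ((Category.id_comp S.g).trans (Eq.trans
          (ChainComplex.toSingle₀Equiv_symm_apply_f_zero (C := Q.splice) S.g
            Q.splice_d_one_zero_comp).symm (Category.comp_id _).symm))
    · rw [quasiIsoAt_iff_exactAt' _ _ (ChainComplex.exactAt_succ_single_obj _ _)]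
      exact Q.exactAt_splice_succ n⟩

end ProjectiveResolution

/-- If `0 ⟶ X₁ ⟶ X₂ ⟶ X₃ ⟶ 0` is short exact with `X₂` projective and a right exact functor `F`
annihilates `X₁ ⟶ X₂`, then the first left derived functor of `F` at `X₃` is `F X₁`. -/
lemma Functor.nonempty_leftDerived_one_iso [HasProjectiveResolutions C] (F : C ⥤ D) [F.Additive]
    [PreservesFiniteColimits F] {S : ShortComplex C} (hS : S.ShortExact) [Projective S.X₂]
    (hF : F.map S.f = 0) : Nonempty ((F.leftDerived 1).obj S.X₃ ≅ F.obj S.X₁) := by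
  let Q := projectiveResolution S.X₁
  let P := Q.ofShortExact hS
  let K := (F.mapHomologicalComplex _).obj P.complex
  have hg : (K.sc' 2 1 0).g = 0 :=
    show F.map (Q.augmentation ≫ S.f) = 0 by rw [F.map_comp, hF, comp_zero]
  exact ⟨P.isoLeftDerivedObj F 1 ≪≫ K.homologyIsoSc' 2 1 0 (by simp) (by simp) ≪≫
    (ShortComplex.HomologyData.ofIsColimitCokernelCofork (K.sc' 2 1 0) hg _
      (CokernelCofork.mapIsColimit _ Q.isColimitAugmentation F)).left.homologyIso⟩

end CategoryTheory

/-- If `A` is a cyclic `S`-algebra and `N` an `A`-module, an `S`-linear map `M → N` with a section `σ`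
whose range spans `M` and which is semilinear over a lift `A → S` induces `A ⊗[S] M ≃ N`. -/
lemma nonempty_tensor_equiv_of_section {S A M N : Type*} [CommRing S] [CommRing A]
    [AddCommGroup M] [AddCommGroup N] [Module S A] [Module S M] [Module S N] [Module A N]
    [IsScalarTower S A N] (φ : M →ₗ[S] N) (σ : N →+ M) (hφσ : ∀ n, φ (σ n) = n)
    (hσ : ∀ a : A, ∃ s : S, s • (1 : A) = a ∧ ∀ n, σ (a • n) = s • σ n)
    (hspan : Submodule.span S (Set.range σ) = ⊤) : Nonempty (A ⊗[S] M ≃ₗ[S] N) := by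
  have hcomm (a : A) (s : S) (n : N) : a • s • n = s • a • n := by
    obtain ⟨t, rfl, -⟩ := hσ a
    rw [smul_assoc, smul_assoc, one_smul, one_smul, smul_comm]
  let f : A ⊗[S] M →ₗ[S] N :=
    TensorProduct.lift (LinearMap.mk₂ S (fun a m => a • φ m)
      (fun _ _ _ => add_smul _ _ _) (fun _ _ _ => smul_assoc _ _ _)
      (fun _ _ _ => by rw [map_add, smul_add]) (fun _ _ _ => by rw [map_smul, hcomm]))
  have hf (a : A) (m : M) : f (a ⊗ₜ m) = a • φ m := rfl
  refine ⟨{ f with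
    invFun := fun n => 1 ⊗ₜ σ n
    left_inv := fun x => ?_
    right_inv := fun n => ?_ }⟩
  · change 1 ⊗ₜ σ (f x) = x
    induction x with
    | zero => rw [map_zero, map_zero, tmul_zero]
    | add x y hx hy => rw [map_add, map_add, tmul_add, hx, hy]
    | tmul a m =>
      have hm : m ∈ Submodule.span S (Set.range σ) := hspan ▸ Submodule.mem_top
      rw [hf]
      induction hm using Submodule.span_induction generalizing a with
      | mem m hm =>
        obtain ⟨n, rfl⟩ := hm
        obtain ⟨s, rfl, hs⟩ := hσ a
        rw [hφσ, hs, smul_tmul]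
      | zero => rw [map_zero, smul_zero, map_zero, tmul_zero, tmul_zero]
      | add m m' _ _ h h' => rw [map_add, smul_add, map_add, tmul_add, tmul_add, h, h']
      | smul s m _ h => rw [φ.map_smul, hcomm, ← smul_assoc, h, smul_tmul]
  · change f (1 ⊗ₜ σ n) = n
    rw [hf, one_smul, hφσ]

/-- Tensoring `J ⟶ S` with a module annihilated by `J` gives zero. -/
lemma tensoringLeft_map_ofHom_subtype_eq_zero {S A : Type} [CommRing S] [AddCommGroup A]
    [Module S A] (J : Ideal S) (h : ∀ s ∈ J, ∀ a : A, s • a = 0) :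
    ((MonoidalCategory.tensoringLeft (ModuleCat S)).obj (ModuleCat.of S A)).map
      (ModuleCat.ofHom J.subtype) = 0 := by
  refine ModuleCat.MonoidalCategory.tensor_ext fun a x => ?_
  change a ⊗ₜ[S] (x : S) = 0
  rw [← mul_one (x : S), ← smul_eq_mul, ← smul_tmul, h _ x.2, zero_tmul]

/-- The surjection `id ⊗ π : R₀ ⊗[k] R → R₀ ⊗[k] R₀`. -/
abbrev idTensorMk : (R ⧸ I) ⊗[k] R →ₐ[k] (R ⧸ I) ⊗[k] (R ⧸ I) :=
  Algebra.TensorProduct.map (AlgHom.id k (R ⧸ I)) (Ideal.Quotient.mkₐ k I)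

lemma idTensorMk_surjective : Function.Surjective (idTensorMk k R I) :=
  TensorProduct.map_surjective Function.surjective_id Ideal.Quotient.mk_surjective

lemma lmul'_idTensorMk (s : (R ⧸ I) ⊗[k] R) :
    Algebra.TensorProduct.lmul' k (idTensorMk k R I s) = gmap k R I s := by
  have : (Algebra.TensorProduct.lmul' k).comp (idTensorMk k R I) = gmap k R I := by
    ext <;> simp [gmap]
  exact DFunLike.congr_fun this s

lemma gmap_eq_zero_of_mem_ker {s : (R ⧸ I) ⊗[k] R} (hs : s ∈ RingHom.ker (idTensorMk k R I)) :
    gmap k R I s = 0 := by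
  rw [← lmul'_idTensorMk, RingHom.mem_ker.1 hs, map_zero]

/-- The multiplication `R₀ ⊗ (R₀ ⊗[k] R₀) → R₀`, where the outer tensor product is over
`R₀ ⊗[k] R`, is an isomorphism. -/
lemma nonempty_tensor_RR0_equiv :
    Nonempty ((R ⧸ I) ⊗[(R ⧸ I) ⊗[k] R] ((R ⧸ I) ⊗[k] (R ⧸ I)) ≃ₗ[(R ⧸ I) ⊗[k] R] (R ⧸ I)) := by
  let f : (R ⧸ I) ⊗[(R ⧸ I) ⊗[k] R] ((R ⧸ I) ⊗[k] (R ⧸ I)) →ₗ[(R ⧸ I) ⊗[k] R] (R ⧸ I) :=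
    TensorProduct.lift (LinearMap.mk₂ _
      (fun r x => r * Algebra.TensorProduct.lmul' k x)
      (fun _ _ _ => add_mul _ _ _)
      (fun _ _ _ => mul_assoc _ _ _)
      (fun _ _ _ => by rw [map_add, mul_add])
      (fun s r x => by
        change r * Algebra.TensorProduct.lmul' k (idTensorMk k R I s * x) = gmap k R I s * _
        rw [map_mul, lmul'_idTensorMk, mul_left_comm]))
  refine ⟨{ f with
    invFun := fun r => r ⊗ₜ 1
    left_inv := fun x => ?_
    right_inv := fun r => ?_ }⟩
  · change f x ⊗ₜ[(R ⧸ I) ⊗[k] R] 1 = x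
    induction x with
    | zero => rw [map_zero, zero_tmul]
    | add x y hx hy => rw [map_add, add_tmul, hx, hy]
    | tmul r y =>
      obtain ⟨s, rfl⟩ := idTensorMk_surjective k R I y
      have h : idTensorMk k R I s = s • (1 : (R ⧸ I) ⊗[k] (R ⧸ I)) := (mul_one _).symm
      have h' : f (r ⊗ₜ idTensorMk k R I s) = s • r := by
        change r * Algebra.TensorProduct.lmul' k (idTensorMk k R I s) = gmap k R I s * r
        rw [lmul'_idTensorMk, mul_comm]
      rw [h', h, smul_tmul]
  · change r * Algebra.TensorProduct.lmul' k 1 = r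
    rw [map_one, mul_one]

lemma exact_lTensor_idTensorMk :
    Function.Exact ((I.subtype.restrictScalars k).lTensor (R ⧸ I)) (idTensorMk k R I) :=
  lTensor_exact (f := I.subtype.restrictScalars k) (g := (Ideal.Quotient.mkₐ k I).toLinearMap)
    (R ⧸ I) (fun x => by simp [Ideal.Quotient.eq_zero_iff_mem]) Ideal.Quotient.mk_surjective

/-- When `R₀` is flat over `k`, the kernel of `id ⊗ π` is `R₀ ⊗[k] I`. -/
def tensorIdealEquivKer [Module.Flat k (R ⧸ I)] :
    (R ⧸ I) ⊗[k] I ≃+ RingHom.ker (idTensorMk k R I) :=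
  AddEquiv.ofBijective
    (((I.subtype.restrictScalars k).lTensor (R ⧸ I)).toAddMonoidHom.codRestrict
      (RingHom.ker (idTensorMk k R I)) fun x => (exact_lTensor_idTensorMk k R I _).2 ⟨x, rfl⟩)
    ⟨fun x y h => Module.Flat.lTensor_preserves_injective_linearMap (M := R ⧸ I)
        (I.subtype.restrictScalars k) I.subtype_injective (congrArg Subtype.val h),
      fun y => by
        obtain ⟨x, hx⟩ := (exact_lTensor_idTensorMk k R I _).1 y.2
        exact ⟨x, Subtype.ext hx⟩⟩

lemma smul_tensorIdealEquivKer_tmul [Module.Flat k (R ⧸ I)] (a b : R ⧸ I) (r : R) (i : I) :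
    (a ⊗ₜ[k] r) • tensorIdealEquivKer k R I (b ⊗ₜ i) =
      tensorIdealEquivKer k R I ((a * b) ⊗ₜ (r • i)) :=
  Subtype.ext (Algebra.TensorProduct.tmul_mul_tmul a b r (i : R))

variable {R I}

lemma Imodule_mk_smul (hI : I ^ 2 = ⊥) (r : R) (i : I) :
    letI := Imodule R I hI
    Ideal.Quotient.mk I r • i = r • i :=
  rfl

/-- The multiplication map `R₀ ⊗[k] I → I`. -/
def tensorIdealMul (hI : I ^ 2 = ⊥) : (R ⧸ I) ⊗[k] I →ₗ[k] I :=
  letI := Imodule R I hI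
  TensorProduct.lift (LinearMap.mk₂ k (fun (a : R ⧸ I) (i : I) => a • i)
    (fun _ _ _ => add_smul _ _ _)
    (fun c a i => by
      obtain ⟨a, rfl⟩ := Ideal.Quotient.mk_surjective a
      exact smul_assoc c a i)
    (fun _ _ _ => smul_add _ _ _)
    (fun c a i => by
      obtain ⟨a, rfl⟩ := Ideal.Quotient.mk_surjective a
      exact smul_comm a c i))

lemma tensorIdealMul_tmul (hI : I ^ 2 = ⊥) (a : R ⧸ I) (i : I) :
    letI := Imodule R I hI
    tensorIdealMul k hI (a ⊗ₜ i) = a • i :=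
  rfl

/-- The kernel of `id ⊗ π` maps to `I` by multiplication. -/
def kerToIdeal [Module.Flat k (R ⧸ I)] (hI : I ^ 2 = ⊥) :
    letI := Imodule R I hI
    letI : Module ((R ⧸ I) ⊗[k] R) I := Module.compHom I (gmap k R I).toRingHom
    RingHom.ker (idTensorMk k R I) →ₗ[(R ⧸ I) ⊗[k] R] I :=
  letI := Imodule R I hI
  letI : Module ((R ⧸ I) ⊗[k] R) I := Module.compHom I (gmap k R I).toRingHom
  { toFun := fun x => tensorIdealMul k hI ((tensorIdealEquivKer k R I).symm x)
    map_add' := fun x y => by rw [AddEquiv.map_add, map_add]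
    map_smul' := fun s x => by
      obtain ⟨x, rfl⟩ := (tensorIdealEquivKer k R I).surjective x
      rw [AddEquiv.symm_apply_apply, RingHom.id_apply]
      induction s with
      | zero =>
        have h : (0 : (R ⧸ I) ⊗[k] R) • tensorIdealEquivKer k R I x = 0 :=
          Subtype.ext (zero_mul _)
        have h' : (0 : (R ⧸ I) ⊗[k] R) • tensorIdealMul k hI x = 0 := by
          change gmap k R I 0 • tensorIdealMul k hI x = 0
          rw [map_zero, zero_smul]
        exact (congrArg (tensorIdealMul k hI) ((congrArg _ h).trans (AddEquiv.map_zero _))).trans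
          ((map_zero _).trans h'.symm)
      | add s t hs ht => rw [add_smul, AddEquiv.map_add, map_add, hs, ht, add_smul]
      | tmul a r =>
        induction x with
        | zero => rw [AddEquiv.map_zero, smul_zero, AddEquiv.map_zero, map_zero, smul_zero]
        | add x y hx hy =>
          rw [AddEquiv.map_add, smul_add, AddEquiv.map_add, map_add, hx, hy, map_add, smul_add]
        | tmul b i =>
          rw [smul_tensorIdealEquivKer_tmul, AddEquiv.symm_apply_apply, tensorIdealMul_tmul,
            tensorIdealMul_tmul]
          change _ = (a * Ideal.Quotient.mk I r) • b • i
          rw [← Imodule_mk_smul hI, smul_smul, smul_smul, mul_right_comm] }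

lemma kerToIdeal_tmul [Module.Flat k (R ⧸ I)] (hI : I ^ 2 = ⊥) (a : R ⧸ I) (i : I) :
    letI := Imodule R I hI
    kerToIdeal k hI (tensorIdealEquivKer k R I (a ⊗ₜ i)) = a • i := by
  change tensorIdealMul k hI _ = _
  rw [AddEquiv.symm_apply_apply, tensorIdealMul_tmul]

/-- `R₀ ⊗ ker (id ⊗ π)`, where the tensor product is over `R₀ ⊗[k] R`, is isomorphic to `I`. -/
lemma nonempty_tensor_ker_equiv [Module.Flat k (R ⧸ I)] (hI : I ^ 2 = ⊥) :
    letI := Imodule R I hI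
    letI : Module ((R ⧸ I) ⊗[k] R) I := Module.compHom I (gmap k R I).toRingHom
    Nonempty ((R ⧸ I) ⊗[(R ⧸ I) ⊗[k] R] RingHom.ker (idTensorMk k R I) ≃ₗ[(R ⧸ I) ⊗[k] R] I) := by
  let := Imodule R I hI
  let : Module ((R ⧸ I) ⊗[k] R) I := Module.compHom I (gmap k R I).toRingHom
  have : IsScalarTower ((R ⧸ I) ⊗[k] R) (R ⧸ I) I := ⟨fun _ _ _ => mul_smul _ _ _⟩
  let σ : I →+ RingHom.ker (idTensorMk k R I) :=
    (tensorIdealEquivKer k R I).toAddMonoidHom.comp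
      (TensorProduct.mk k (R ⧸ I) I 1).toAddMonoidHom
  refine nonempty_tensor_equiv_of_section (kerToIdeal k hI) σ
    (fun i => (kerToIdeal_tmul k hI 1 i).trans (one_smul _ i)) (fun a => ?_) ?_
  · obtain ⟨r, rfl⟩ := Ideal.Quotient.mk_surjective a
    refine ⟨1 ⊗ₜ r, ?_, fun i => ?_⟩
    · change gmap k R I (1 ⊗ₜ r) * 1 = _
      simp [gmap]
    · have h := smul_tensorIdealEquivKer_tmul k R I 1 1 r i
      rw [one_mul] at h
      exact h.symm
  · refine eq_top_iff.2 fun y _ => ?_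
    obtain ⟨y, rfl⟩ := (tensorIdealEquivKer k R I).surjective y
    induction y with
    | zero => rw [AddEquiv.map_zero]; exact zero_mem _
    | add x y hx hy => rw [AddEquiv.map_add]; exact add_mem (hx trivial) (hy trivial)
    | tmul a i =>
      have h := smul_tensorIdealEquivKer_tmul k R I a 1 1 i
      rw [mul_one, one_smul] at h
      rw [← h]
      exact Submodule.smul_mem _ _ (Submodule.subset_span ⟨i, rfl⟩)

variable (R I)

/-- The short exact sequence `0 ⟶ ker (id ⊗ π) ⟶ R₀ ⊗[k] R ⟶ R₀ ⊗[k] R₀ ⟶ 0`. -/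
abbrev kerShortComplex : ShortComplex (ModuleCat ((R ⧸ I) ⊗[k] R)) :=
  ShortComplex.mk
    (X₁ := ModuleCat.of _ (RingHom.ker (idTensorMk k R I)))
    (X₂ := ModuleCat.of _ ((R ⧸ I) ⊗[k] R))
    (X₃ := ModuleCat.of _ ((R ⧸ I) ⊗[k] (R ⧸ I)))
    (ModuleCat.ofHom (RingHom.ker (idTensorMk k R I)).subtype)
    (ModuleCat.ofHom (LinearMap.toSpanSingleton _ _ 1))
    (by
      ext x
      exact (mul_one _).trans x.2)

lemma shortExact_kerShortComplex : (kerShortComplex k R I).ShortExact where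
  exact := by
    rw [ShortComplex.ShortExact.moduleCat_exact_iff_function_exact]
    intro s
    have h : ((kerShortComplex k R I).g : _ → _) s = idTensorMk k R I s := mul_one _
    rw [h]
    exact ⟨fun hs => ⟨⟨s, hs⟩, rfl⟩, by rintro ⟨x, rfl⟩; exact x.2⟩
  mono_f := (ModuleCat.mono_iff_injective _).2 Subtype.val_injective
  epi_g := (ModuleCat.epi_iff_surjective _).2 fun x => by
    obtain ⟨s, rfl⟩ := idTensorMk_surjective k R I x
    exact ⟨s, mul_one _⟩

lemma tensor_kerShortComplex_f :
    ((MonoidalCategory.tensoringLeft (ModuleCat ((R ⧸ I) ⊗[k] R))).obj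
      (ModuleCat.of ((R ⧸ I) ⊗[k] R) (R ⧸ I))).map (kerShortComplex k R I).f = 0 := by
  refine tensoringLeft_map_ofHom_subtype_eq_zero _ fun s hs r => ?_
  change gmap k R I s * r = 0
  rw [gmap_eq_zero_of_mem_ker k R I hs, zero_mul]

instance {S : Type*} [CommRing S] (X : ModuleCat S) :
    Limits.PreservesFiniteColimits ((MonoidalCategory.tensoringLeft (ModuleCat S)).obj X) :=
  have : Limits.PreservesColimits ((MonoidalCategory.tensoringLeft (ModuleCat S)).obj X) :=
    (ihom.adjunction X).leftAdjoint_preservesColimits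
  inferInstance

theorem statement6 (hI : I ^ 2 = ⊥) [Module.Flat k (R ⧸ I)] :
    letI : Module (R ⧸ I) I := Imodule R I hI
    letI : Module ((R ⧸ I) ⊗[k] R) I := Module.compHom I (gmap k R I).toRingHom
    Nonempty
        ((((Tor (ModuleCat ((R ⧸ I) ⊗[k] R)) 0).obj
              (ModuleCat.of ((R ⧸ I) ⊗[k] R) (R ⧸ I))).obj
            (ModuleCat.of ((R ⧸ I) ⊗[k] R) ((R ⧸ I) ⊗[k] (R ⧸ I)))) ≅
          ModuleCat.of ((R ⧸ I) ⊗[k] R) (R ⧸ I)) ∧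
      Nonempty
        ((((Tor (ModuleCat ((R ⧸ I) ⊗[k] R)) 1).obj
              (ModuleCat.of ((R ⧸ I) ⊗[k] R) (R ⧸ I))).obj
            (ModuleCat.of ((R ⧸ I) ⊗[k] R) ((R ⧸ I) ⊗[k] (R ⧸ I)))) ≅
          ModuleCat.of ((R ⧸ I) ⊗[k] R) I) := by
  let : Module (R ⧸ I) I := Imodule R I hI
  let : Module ((R ⧸ I) ⊗[k] R) I := Module.compHom I (gmap k R I).toRingHom
  let F := (MonoidalCategory.tensoringLeft (ModuleCat ((R ⧸ I) ⊗[k] R))).obj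
    (ModuleCat.of ((R ⧸ I) ⊗[k] R) (R ⧸ I))
  obtain ⟨e₀⟩ := nonempty_tensor_RR0_equiv k R I
  obtain ⟨e₁⟩ := nonempty_tensor_ker_equiv k hI
  have : Projective (kerShortComplex k R I).X₂ :=
    (IsProjective.iff_projective _).1 inferInstance
  obtain ⟨t⟩ := F.nonempty_leftDerived_one_iso (shortExact_kerShortComplex k R I)
    (tensor_kerShortComplex_f k R I)
  exact ⟨⟨F.leftDerivedZeroIsoSelf.app _ ≪≫ e₀.toModuleIso⟩, ⟨t ≪≫ e₁.toModuleIso⟩⟩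

end
end

section
/- Let R be a commutative Noetherian ring and let F^• be a bounded cochain complex of finitely generated free R-modules such that for every maximal ideal m ⊆ R and every integer i ∉ {1,2}, the i-th cohomology of the complex F^• ⊗_R (R/m) vanishes. Then F^• is isomorphic, in the derived category of R-modules, to a cochain complex G^• of finitely generated projective R-modules with G^i = 0 for all i ∉ {1,2}; more precisely, F^• and G^• are connected by a finite chain of quasi-isomorphisms of cochain complexes. -/
/-!
STATEMENT 12: Let `R` be a commutative Noetherian ring and `F` a bounded cochain
complex of finitely generated free `R`-modules such that for every maximal ideal `m`
the cohomology of `F ⊗ R/m` vanishes in all degrees `i ∉ {1,2}`. Then `F` is connected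
by a finite chain of quasi-isomorphisms (a roof) to a cochain complex `G` of finitely
generated projective modules concentrated in degrees 1 and 2.
-/

open CategoryTheory CategoryTheory.Limits CategoryTheory.MonoidalCategory

noncomputable section

theorem LinearMap.exists_comp_add_comp_eq_id_of_exact {k A B C : Type*} [Field k]
    [AddCommGroup A] [Module k A] [AddCommGroup B] [Module k B] [AddCommGroup C] [Module k C]
    (f : A →ₗ[k] B) (g : B →ₗ[k] C) (hfg : Function.Exact f g) :
    ∃ (s : C →ₗ[k] B) (t : B →ₗ[k] A), s ∘ₗ g + f ∘ₗ t = LinearMap.id := by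
  obtain ⟨r, hr⟩ := g.rangeRestrict.exists_rightInverse_of_surjective g.range_rangeRestrict
  obtain ⟨s, hs⟩ := LinearMap.exists_extend r
  have hgs (x : B) : g (s (g x)) = g x := by
    have h1 : s (g x) = r (g.rangeRestrict x) := LinearMap.congr_fun hs (g.rangeRestrict x)
    rw [h1]
    exact congrArg Subtype.val (LinearMap.congr_fun hr (g.rangeRestrict x))
  obtain ⟨t, ht⟩ := Module.projective_lifting_property f.rangeRestrict
    ((LinearMap.id - s ∘ₗ g).codRestrict (LinearMap.range f) fun x ↦
      (hfg _).mp (by simp [hgs])) f.surjective_rangeRestrict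
  refine ⟨s, t, LinearMap.ext fun x ↦ ?_⟩
  have hx : f (t x) = x - s (g x) := congrArg Subtype.val (LinearMap.congr_fun ht x)
  simp [hx]

section

variable {R A B C : Type*} [CommRing R] [AddCommGroup A] [Module R A] [AddCommGroup B] [Module R B]
  [AddCommGroup C] [Module R C]

open TensorProduct in
theorem LinearMap.exists_range_comp_add_comp_sub_id_le_smul [Module.Projective R B]
    [Module.Projective R C] (f : A →ₗ[R] B) (g : B →ₗ[R] C) (m : Ideal R) [hm : m.IsMaximal]
    (hfg : Function.Exact (f.rTensor (R ⧸ m)) (g.rTensor (R ⧸ m))) :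
    ∃ (s : C →ₗ[R] B) (t : B →ₗ[R] A),
      LinearMap.range (s ∘ₗ g + f ∘ₗ t - LinearMap.id) ≤ m • ⊤ := by
  have hfg' : Function.Exact (f.baseChange (R ⧸ m)) (g.baseChange (R ⧸ m)) := by
    change Function.Exact (f.lTensor (R ⧸ m)) (g.lTensor (R ⧸ m))
    refine Function.Exact.of_ladder_linearEquiv_of_exact (e₁ := TensorProduct.comm R A (R ⧸ m))
      (e₂ := TensorProduct.comm R B (R ⧸ m)) (e₃ := TensorProduct.comm R C (R ⧸ m)) ?_ ?_ hfg
      <;> ext <;> simp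
  let := Ideal.Quotient.field m
  obtain ⟨s, t, hst⟩ := LinearMap.exists_comp_add_comp_eq_id_of_exact _ _ hfg'
  obtain ⟨s', hs'⟩ := Module.projective_lifting_property (TensorProduct.mk R (R ⧸ m) B 1)
    (s.restrictScalars R ∘ₗ TensorProduct.mk R (R ⧸ m) C 1)
    (TensorProduct.mk_surjective R B (R ⧸ m) Ideal.Quotient.mk_surjective)
  obtain ⟨t', ht'⟩ := Module.projective_lifting_property (TensorProduct.mk R (R ⧸ m) A 1)
    (t.restrictScalars R ∘ₗ TensorProduct.mk R (R ⧸ m) B 1)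
    (TensorProduct.mk_surjective R A (R ⧸ m) Ideal.Quotient.mk_surjective)
  refine ⟨s', t', ?_⟩
  rintro _ ⟨x, rfl⟩
  rw [← Submodule.Quotient.mk_eq_zero, ← TensorProduct.quotTensorEquivQuotSMul_mk_one_tmul,
    LinearEquiv.map_eq_zero_iff]
  have h1 : (1 : R ⧸ m) ⊗ₜ[R] s' (g x) = s (1 ⊗ₜ g x) := LinearMap.congr_fun hs' (g x)
  have h2 : (1 : R ⧸ m) ⊗ₜ[R] t' x = t (1 ⊗ₜ x) := LinearMap.congr_fun ht' x
  have h3 := LinearMap.congr_fun hst (1 ⊗ₜ x)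
  simp only [LinearMap.add_apply, LinearMap.comp_apply, LinearMap.baseChange_tmul,
    LinearMap.id_apply, ← h1, ← h2] at h3
  simp [TensorProduct.tmul_sub, TensorProduct.tmul_add, h3]

/-- The endomorphisms of the middle term of `A → B → C` which are null-homotopic there. -/
def LinearMap.nullHomotopic (f : A →ₗ[R] B) (g : B →ₗ[R] C) : Submodule R (Module.End R B) where
  carrier := {φ | ∃ (s : C →ₗ[R] B) (t : B →ₗ[R] A), s ∘ₗ g + f ∘ₗ t = φ}
  zero_mem' := ⟨0, 0, by simp⟩
  add_mem' := by
    rintro _ _ ⟨s, t, rfl⟩ ⟨s', t', rfl⟩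
    exact ⟨s + s', t + t', by ext; simp; abel⟩
  smul_mem' := by
    rintro r _ ⟨s, t, rfl⟩
    exact ⟨r • s, r • t, by ext; simp⟩

theorem LinearMap.mul_mem_nullHomotopic {f : A →ₗ[R] B} {g : B →ₗ[R] C} (hgf : g ∘ₗ f = 0)
    {φ ψ : Module.End R B} (hφ : φ ∈ nullHomotopic f g) (hψ : ψ ∈ nullHomotopic f g) :
    φ * ψ ∈ nullHomotopic f g := by
  obtain ⟨s, t, rfl⟩ := hφ
  obtain ⟨s', t', rfl⟩ := hψ
  refine ⟨(s ∘ₗ g + f ∘ₗ t) ∘ₗ s', t ∘ₗ f ∘ₗ t', LinearMap.ext fun x ↦ ?_⟩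
  have h (y : A) : g (f y) = 0 := LinearMap.congr_fun hgf y
  simp [h]
  abel

/-- A three-term complex which is exact modulo every maximal ideal is contractible in the
middle. -/
theorem LinearMap.exists_comp_add_comp_eq_id_of_forall_exact_rTensor [Module.Finite R B]
    [Module.Projective R B] [Module.Projective R C] (f : A →ₗ[R] B) (g : B →ₗ[R] C)
    (hgf : g ∘ₗ f = 0) (hfg : ∀ m : Ideal R, m.IsMaximal →
      Function.Exact (f.rTensor (R ⧸ m)) (g.rTensor (R ⧸ m))) :
    ∃ (s : C →ₗ[R] B) (t : B →ₗ[R] A), s ∘ₗ g + f ∘ₗ t = LinearMap.id := by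
  suffices h : (nullHomotopic f g).comap (Algebra.linearMap R (Module.End R B)) = ⊤ by
    have h1 := (Ideal.eq_top_iff_one _).mp h
    rwa [Submodule.mem_comap, Algebra.linearMap_apply, map_one] at h1
  by_contra hne
  obtain ⟨m, hm, hle⟩ := Ideal.exists_le_maximal _ hne
  obtain ⟨s, t, hst⟩ := exists_range_comp_add_comp_sub_id_le_smul f g m (hfg m hm)
  set u : Module.End R B := s ∘ₗ g + f ∘ₗ t with hu
  have hpow (n : ℕ) : u ^ (n + 1) ∈ nullHomotopic f g := by
    induction n with
    | zero => exact ⟨s, t, by simp [hu]⟩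
    | succ n ih => rw [pow_succ]; exact mul_mem_nullHomotopic hgf ih ⟨s, t, rfl⟩
  obtain ⟨p, hp, -, hcoeff, hp0⟩ :=
    exists_monic_and_natDegree_eq_and_coeff_mem_pow_and_aeval_eq_zero R (u - 1) m hst
  let q := p.comp (Polynomial.X - 1)
  have hq : Polynomial.aeval u q = 0 := by simpa [q, Polynomial.aeval_comp] using hp0
  have hq0 : q.coeff 0 ∈ m := by
    refine hle ?_
    have h := hq
    rw [← Polynomial.divX_mul_X_add q, map_add, map_mul, Polynomial.aeval_X, Polynomial.aeval_C,
      add_eq_zero_iff_neg_eq] at h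
    change algebraMap R (Module.End R B) (q.coeff 0) ∈ nullHomotopic f g
    rw [← h, Polynomial.aeval_eq_sum_range, Finset.sum_mul]
    refine neg_mem (sum_mem fun i _ ↦ ?_)
    rw [smul_mul_assoc, ← pow_succ]
    exact Submodule.smul_mem _ _ (hpow i)
  have hpm : p.map (Ideal.Quotient.mk m) = Polynomial.X ^ p.natDegree := by
    ext i
    rw [Polynomial.coeff_map, Polynomial.coeff_X_pow]
    split_ifs with hi
    · rw [hi, hp.coeff_natDegree, map_one]
    · obtain hlt | hlt := lt_or_gt_of_ne hi
      · exact Ideal.Quotient.eq_zero_iff_mem.mpr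
          (Ideal.pow_le_self (Nat.sub_ne_zero_of_lt hlt) (hcoeff i))
      · rw [Polynomial.coeff_eq_zero_of_natDegree_lt hlt, map_zero]
  have heval : (Ideal.Quotient.mk m) (q.coeff 0) = (-1) ^ p.natDegree := by
    rw [← Polynomial.coeff_map, Polynomial.map_comp, hpm, Polynomial.coeff_zero_eq_eval_zero]
    simp
  rw [Ideal.Quotient.eq_zero_iff_mem.mpr hq0] at heval
  have : Nontrivial (R ⧸ m) := Ideal.Quotient.nontrivial_iff.mpr hm.ne_top
  exact ((isUnit_one.neg).pow p.natDegree).ne_zero heval.symm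

end


namespace HomologicalComplex

variable {C ι : Type*} [Category* C] [Preadditive C] {c : ComplexShape ι}
  (K : HomologicalComplex C c)

/-- If `K.d i j` has a pseudo-inverse, then the cycles in degree `i` are a retract of `K.X i`. -/
def retractCycles (i j : ι) [K.HasHomology i] (hij : c.Rel i j) (t : K.X j ⟶ K.X i)
    (ht : K.d i j ≫ t ≫ K.d i j = K.d i j) : Retract (K.cycles i) (K.X i) where
  i := K.iCycles i
  r := K.liftCycles (𝟙 _ - K.d i j ≫ t) j (c.next_eq' hij) (by simp [ht])
  retract := by simp [← cancel_mono (K.iCycles i)]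

/-- If `K.d i j` has a pseudo-inverse, then the opcycles in degree `j` are a retract of `K.X j`. -/
def retractOpcycles (i j : ι) [K.HasHomology j] (hij : c.Rel i j) (t : K.X j ⟶ K.X i)
    (ht : K.d i j ≫ t ≫ K.d i j = K.d i j) : Retract (K.opcycles j) (K.X j) where
  i := K.descOpcycles (𝟙 _ - t ≫ K.d i j) i (c.prev_eq' hij) (by simp [ht])
  r := K.pOpcycles j
  retract := by simp [← cancel_epi (K.pOpcycles j)]

end HomologicalComplex

namespace HomologicalComplex

variable {C ι ι' : Type*} [Category* C] [HasZeroMorphisms C] [HasZeroObject C]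
  {c : ComplexShape ι} {c' : ComplexShape ι'}
  (K : HomologicalComplex C c') (e : c.Embedding c') [∀ i', K.HasHomology i']

theorem isIso_πTruncGE_f [e.IsTruncGE] {i : ι} {i' : ι'} (hi' : e.f i = i')
    (hi : ¬ e.BoundaryGE i) : IsIso ((K.πTruncGE e).f i') :=
  (e.isIso_liftExtend_f_iff _ _ hi').mpr (K.isIso_restrictionToTruncGE' e i hi)

theorem isIso_ιTruncLE_f [e.IsTruncLE] {i : ι} {i' : ι'} (hi' : e.f i = i')
    (hi : ¬ e.BoundaryLE i) : IsIso ((K.ιTruncLE e).f i') := by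
  have : IsIso ((K.op.πTruncGE e.op).f i') := K.op.isIso_πTruncGE_f e.op hi' (by simpa)
  exact inferInstanceAs (IsIso ((K.op.πTruncGE e.op).f i').unop)

end HomologicalComplex

namespace CochainComplex

theorem isIso_ιTruncLE_f {C : Type*} [Category* C] [HasZeroMorphisms C] [HasZeroObject C]
    (K : CochainComplex C ℤ) [∀ i, K.HasHomology i] (n i : ℤ) (hi : i < n) :
    IsIso ((K.ιTruncLE n).f i) :=
  HomologicalComplex.isIso_ιTruncLE_f K (ComplexShape.embeddingUpIntLE n)
    (i := (n - i).natAbs) (by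
      change n - ((n - i).natAbs : ℤ) = i
      lia) fun h ↦ by
      rw [ComplexShape.boundaryLE_embeddingUpIntLE_iff, Int.natAbs_eq_zero] at h
      lia

variable {R : Type*} [CommRing R] (F : CochainComplex (ModuleCat R) ℤ)

theorem exactAt_of_comp_add_comp_eq_id {i j k : ℤ} (hij : i + 1 = j) (hjk : j + 1 = k)
    (s : F.X k ⟶ F.X j) (t : F.X j ⟶ F.X i) (h : F.d j k ≫ s + t ≫ F.d i j = 𝟙 _) :
    F.ExactAt j := by
  rw [F.exactAt_iff' i j k (by simp; lia) (by simp; lia), ShortComplex.moduleCat_exact_iff]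
  intro x hx
  refine ⟨t x, ?_⟩
  have hx' : F.d j k x = 0 := hx
  have hst : s (F.d j k x) + F.d i j (t x) = x :=
    LinearMap.congr_fun (congrArg ModuleCat.Hom.hom h) x
  rw [hx', map_zero, zero_add] at hst
  exact hst

end CochainComplex

theorem ModuleCat.finite_projective_of_retract {R : Type*} [Ring R] {M N : ModuleCat R}
    (h : Retract N M) (hM : Module.Finite R M ∧ Module.Projective R M) :
    Module.Finite R N ∧ Module.Projective R N := by
  obtain ⟨_, _⟩ := hM
  have hri (x : N) : h.r (h.i x) = x :=
    LinearMap.congr_fun (congrArg ModuleCat.Hom.hom h.retract) x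
  exact ⟨.of_surjective h.r.hom fun x ↦ ⟨_, hri x⟩,
    .of_split h.i.hom h.r.hom (LinearMap.ext hri)⟩

theorem CochainComplex.exists_comp_add_comp_eq_id {R : Type*} [CommRing R]
    (F : CochainComplex (ModuleCat R) ℤ) {i j k : ℤ} (hij : i + 1 = j) (hjk : j + 1 = k)
    [Module.Finite R (F.X j)] [Module.Projective R (F.X j)] [Module.Projective R (F.X k)]
    (hcoh : ∀ m : Ideal R, m.IsMaximal →
      IsZero ((((tensorRight (ModuleCat.of R (R ⧸ m))).mapHomologicalComplex
          (ComplexShape.up ℤ)).obj F).homology j)) :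
    ∃ (s : F.X k ⟶ F.X j) (t : F.X j ⟶ F.X i), F.d j k ≫ s + t ≫ F.d i j = 𝟙 _ := by
  obtain ⟨s, t, h⟩ := LinearMap.exists_comp_add_comp_eq_id_of_forall_exact_rTensor
    (F.d i j).hom (F.d j k).hom (by rw [← ModuleCat.hom_comp, F.d_comp_d]; rfl) fun m hm ↦ by
      have h := hcoh m hm
      rw [← HomologicalComplex.exactAt_iff_isZero_homology,
        HomologicalComplex.exactAt_iff' _ i j k (by simp; lia) (by simp; lia),
        ShortComplex.ShortExact.moduleCat_exact_iff_function_exact] at h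
      exact h
  exact ⟨ModuleCat.ofHom s, ModuleCat.ofHom t, ModuleCat.hom_ext h⟩

theorem statement12 (R : Type) [CommRing R] [IsNoetherianRing R]
    (F : CochainComplex (ModuleCat R) ℤ)
    (hbdd : ∃ a b : ℤ, ∀ i : ℤ, (i < a ∨ b < i) → IsZero (F.X i))
    (hfree : ∀ i, Module.Free R (F.X i))
    (hfg : ∀ i, Module.Finite R (F.X i))
    (hcoh : ∀ m : Ideal R, m.IsMaximal → ∀ i : ℤ, i ≠ 1 → i ≠ 2 →
      IsZero ((((tensorRight (ModuleCat.of R (R ⧸ m))).mapHomologicalComplex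
          (ComplexShape.up ℤ)).obj F).homology i)) :
    ∃ G : CochainComplex (ModuleCat R) ℤ,
      (∀ i, Module.Finite R (G.X i) ∧ Module.Projective R (G.X i)) ∧
      (∀ i : ℤ, i ≠ 1 → i ≠ 2 → IsZero (G.X i)) ∧
      ∃ (W : CochainComplex (ModuleCat R) ℤ) (f : W ⟶ F) (g : W ⟶ G),
        QuasiIso f ∧ QuasiIso g := by
  have hF (i : ℤ) : Module.Finite R (F.X i) ∧ Module.Projective R (F.X i) := ⟨hfg i, inferInstance⟩
  have hcontr {i j k : ℤ} (hij : i + 1 = j) (hjk : j + 1 = k) (h1 : j ≠ 1) (h2 : j ≠ 2) :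
      ∃ (s : F.X k ⟶ F.X j) (t : F.X j ⟶ F.X i), F.d j k ≫ s + t ≫ F.d i j = 𝟙 _ :=
    F.exists_comp_add_comp_eq_id hij hjk fun m hm ↦ hcoh m hm j h1 h2
  have hexact (j : ℤ) (h1 : j ≠ 1) (h2 : j ≠ 2) : F.ExactAt j := by
    obtain ⟨s, t, h⟩ := hcontr (sub_add_cancel j 1) rfl h1 h2
    exact F.exactAt_of_comp_add_comp_eq_id (sub_add_cancel j 1) rfl s t h
  have : F.IsLE 2 := (F.isLE_iff 2).mpr fun i hi ↦ hexact i (by lia) (by lia)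
  have : (F.truncLE 2).IsGE 1 := ((F.truncLE 2).isGE_iff 1).mpr fun i hi ↦
    (quasiIsoAt_iff_exactAt' (F.ιTruncLE 2) i (hexact i (by lia) (by lia))).mp inferInstance
  have hW1 : Module.Finite R ((F.truncLE 2).X 1) ∧ Module.Projective R ((F.truncLE 2).X 1) :=
    ModuleCat.finite_projective_of_retract (.ofIso (F.truncLEXIso 2 1)) (hF 1)
  have hW2 : Module.Finite R ((F.truncLE 2).X 2) ∧ Module.Projective R ((F.truncLE 2).X 2) := by
    obtain ⟨s, t, h⟩ := hcontr (i := 2) (j := 3) (k := 4) rfl rfl (by lia) (by lia)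
    refine ModuleCat.finite_projective_of_retract (.ofIso (F.truncLEXIsoCycles 2))
      (ModuleCat.finite_projective_of_retract (F.retractCycles 2 3 rfl t ?_) (hF 2))
    simpa using F.d 2 3 ≫= h
  have hG1 : Module.Finite R ((F.truncLE 2).opcycles 1) ∧
      Module.Projective R ((F.truncLE 2).opcycles 1) := by
    obtain ⟨s, t, h⟩ := hcontr (i := -1) (j := 0) (k := 1) rfl rfl (by lia) (by lia)
    have := F.isIso_ιTruncLE_f 2 0 (by lia)
    have hs : F.d 0 1 ≫ s ≫ F.d 0 1 = F.d 0 1 := by simpa using h =≫ F.d 0 1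
    refine ModuleCat.finite_projective_of_retract ((F.truncLE 2).retractOpcycles 0 1 rfl
      ((F.ιTruncLE 2).f 1 ≫ s ≫ inv ((F.ιTruncLE 2).f 0)) ?_) hW1
    have : Mono ((F.ιTruncLE 2).f 1) := by unfold CochainComplex.ιTruncLE; infer_instance
    simp only [← cancel_mono ((F.ιTruncLE 2).f 1), Category.assoc,
      ← HomologicalComplex.Hom.comm_assoc, ← HomologicalComplex.Hom.comm,
      IsIso.inv_hom_id_assoc, hs]
  have hzero (i : ℤ) (h1 : i ≠ 1) (h2 : i ≠ 2) : IsZero (((F.truncLE 2).truncGE 1).X i) := by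
    obtain hi | hi : i < 1 ∨ 2 < i := by lia
    · exact CochainComplex.isZero_of_isStrictlyGE _ 1 i hi
    · exact CochainComplex.isZero_of_isStrictlyLE _ 2 i hi
  refine ⟨(F.truncLE 2).truncGE 1, fun i ↦ ?_, hzero, F.truncLE 2, F.ιTruncLE 2,
    (F.truncLE 2).πTruncGE 1, inferInstance, inferInstance⟩
  by_cases h1 : i = 1
  · subst h1
    exact ModuleCat.finite_projective_of_retract
      (.ofIso ((F.truncLE 2).truncGEXIsoOpcycles 1)) hG1
  by_cases h2 : i = 2
  · subst h2
    exact ModuleCat.finite_projective_of_retract (.ofIso ((F.truncLE 2).truncGEXIso 1 2)) hW2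
  have := ModuleCat.subsingleton_of_isZero (hzero i h1 h2)
  exact ⟨inferInstance, inferInstance⟩

end
end
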